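/- Let Y be a normed vector space, C ⊆ Y a closed convex cone with {0} ≠ C ⊊ Y, and S ⊆ Y a nonempty set with 0 < e(S,C) < +∞. Then for every r > 0 and every α > 0, the inclusion B(S, αr) ⊆ B(S+C, r) implies α ≤ 1. Consequently, if a set-valued mapping G is C-increasing at x₀ with G(x₀) ⊄ C and 0 < e(G(x₀),C) < +∞, the point u in the defining inclusion B(G(u),αr) ⊆ B(G(x₀)+C,r) must satisfy u ≠ x₀. -/

import Mathlib

open Set Metric EMetric ENNReal Pointwise Filter Topology

/-- Excess of `A` beyond `B`: `e(A,B) = ⨆ a ∈ A, dist(a,B)` in `[0,∞]`. -/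
noncomputable def excess {Y : Type*} [PseudoEMetricSpace Y] (A B : Set Y) : ℝ≥0∞ :=
  ⨆ a ∈ A, EMetric.infEdist a B

/-- `C` is a closed convex cone (containing the origin). -/
def IsClosedConvexCone {Y : Type*} [SeminormedAddCommGroup Y] [NormedSpace ℝ Y]
    (C : Set Y) : Prop :=
  IsClosed C ∧ Convex ℝ C ∧ (0 : Y) ∈ C ∧ ∀ c ∈ C, ∀ t : ℝ, 0 ≤ t → t • c ∈ C

/-- `a` is an admissible bound of metric `C`-increase of `G` at `x₀`. -/
def IsIncBoundAt {X Y : Type*} [PseudoMetricSpace X] [SeminormedAddCommGroup Y]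
    (G : X → Set Y) (C : Set Y) (x₀ : X) (a : ℝ) : Prop :=
  1 < a ∧ ∃ δ : ℝ, 0 < δ ∧ ∀ r : ℝ, 0 < r → r ≤ δ →
    ∃ u ∈ Metric.closedBall x₀ r,
      Metric.cthickening (a * r) (G u) ⊆ Metric.cthickening r (G x₀ + C)

/-- `G` is metrically `C`-increasing at `x₀`. -/
def CIncreasingAt {X Y : Type*} [PseudoMetricSpace X] [SeminormedAddCommGroup Y]
    (G : X → Set Y) (C : Set Y) (x₀ : X) : Prop :=
  ∃ a : ℝ, IsIncBoundAt G C x₀ a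

/-- The exact bound of metric `C`-increase of `G` at `x₀` (in `[0,∞]`). -/
noncomputable def incBound {X Y : Type*} [PseudoMetricSpace X] [SeminormedAddCommGroup Y]
    (G : X → Set Y) (C : Set Y) (x₀ : X) : ℝ≥0∞ :=
  ⨆ a ∈ {a : ℝ | IsIncBoundAt G C x₀ a}, ENNReal.ofReal a

/-- Lower semicontinuity of a set-valued mapping. -/
def LscSV {P Y : Type*} [TopologicalSpace P] [TopologicalSpace Y] (G : P → Set Y) : Prop :=
  ∀ p : P, ∀ A : Set Y, IsOpen A → (G p ∩ A).Nonempty →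
    ∀ᶠ p' in nhds p, (G p' ∩ A).Nonempty

/-- Upper semicontinuity of a set-valued mapping. -/
def UscSV {P Y : Type*} [TopologicalSpace P] [TopologicalSpace Y] (G : P → Set Y) : Prop :=
  ∀ p : P, ∀ A : Set Y, IsOpen A → G p ⊆ A → ∀ᶠ p' in nhds p, G p' ⊆ A

/-- Hausdorff `C`-upper semicontinuity at a point. -/
def HausdorffCUscAt {P Y : Type*} [TopologicalSpace P] [SeminormedAddCommGroup Y]
    (G : P → Set Y) (C : Set Y) (p₀ : P) : Prop :=
  ∀ ε : ℝ, 0 < ε → ∀ᶠ p in nhds p₀, G p ⊆ Metric.cthickening ε (G p₀ + C)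

/-- `C`-concavity of a set-valued mapping. -/
def CConcave {X Y : Type*} [SeminormedAddCommGroup X] [NormedSpace ℝ X]
    [SeminormedAddCommGroup Y] [NormedSpace ℝ Y] (G : X → Set Y) (C : Set Y) : Prop :=
  ∀ x₁ x₂ : X, ∀ t : ℝ, t ∈ Set.Icc (0:ℝ) 1 →
    G (t • x₁ + (1 - t) • x₂) ⊆ t • G x₁ + (1 - t) • G x₂ + C

/-- A set is proximinal if the distance to it is attained from every point. -/
def Proximinal {X : Type*} [PseudoMetricSpace X] (S : Set X) : Prop :=
  ∀ x : X, ∃ s ∈ S, dist x s = Metric.infDist x S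

/-- Metric (Menger) convexity of a metric space. -/
def MetricallyConvex (X : Type*) [PseudoMetricSpace X] : Prop :=
  ∀ a b : X, a ≠ b → ∃ c : X, c ≠ a ∧ c ≠ b ∧ dist a b = dist a c + dist c b

/-- The constant `α_{F,C}` associated with a parameterized set-valued inclusion. -/
noncomputable def alphaFC {P X Y : Type*} [PseudoMetricSpace X] [SeminormedAddCommGroup Y]
    (F : P → X → Set Y) (Cm : P → Set Y) : ℝ≥0∞ :=
  ⨅ q ∈ {q : P × X | ¬ (F q.1 q.2 ⊆ Cm q.1)}, incBound (F q.1) (Cm q.1) q.2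

/-- The constant `α̃_{F,C,R}` associated with a constrained set-valued inclusion. -/
noncomputable def alphaTilde {P X Y : Type*} [PseudoMetricSpace X] [SeminormedAddCommGroup Y]
    (F : P → X → Set Y) (Cm : P → Set Y) (R : P → Set X) : ℝ≥0∞ :=
  ⨅ q ∈ {q : P × X | ¬ (F q.1 q.2 ⊆ Cm q.1) ∧ q.2 ∈ R q.1}, incBound (F q.1) (Cm q.1) q.2

/-- The exact bound of `C`-decrease of a single-valued map: `dec(g,C,x₀) = inc(−g,C,x₀)`. -/
noncomputable def decBound {X Y : Type*} [PseudoMetricSpace X] [SeminormedAddCommGroup Y]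
    (g : X → Y) (C : Set Y) (x₀ : X) : ℝ≥0∞ :=
  incBound (fun x => ({-g x} : Set Y)) C x₀

/-- `g` is `C`-decreasing at `x₀` iff `−g` is `C`-increasing there. -/
def CDecreasingAt {X Y : Type*} [PseudoMetricSpace X] [SeminormedAddCommGroup Y]
    (g : X → Y) (C : Set Y) (x₀ : X) : Prop :=
  CIncreasingAt (fun x => ({-g x} : Set Y)) C x₀

theorem IsClosedConvexCone.add_mem {Y : Type*} [SeminormedAddCommGroup Y] [NormedSpace ℝ Y]
    {C : Set Y} (hC : IsClosedConvexCone C) {a b : Y} (ha : a ∈ C) (hb : b ∈ C) : a + b ∈ C := by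
  have h := hC.2.2.2 _ (hC.2.1 ha hb (by norm_num : (0 : ℝ) ≤ 1 / 2)
    (by norm_num : (0 : ℝ) ≤ 1 / 2) (by norm_num)) 2 (by norm_num)
  rw [← smul_add, smul_smul] at h
  norm_num at h
  exact h

/-- Adding an element of the cone does not increase the distance to the cone. -/
theorem IsClosedConvexCone.infDist_add_le {Y : Type*} [SeminormedAddCommGroup Y]
    [NormedSpace ℝ Y] {C : Set Y} (hC : IsClosedConvexCone C) (s : Y) {c : Y} (hc : c ∈ C) :
    infDist (s + c) C ≤ infDist s C := by
  refine (le_infDist ⟨0, hC.2.2.1⟩).2 fun b hb => ?_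
  simpa using infDist_le_dist_of_mem (x := s + c) (hC.add_mem hb hc)

/-- The distance to a convex set grows at least linearly along a ray issuing from the set. -/
theorem Convex.one_add_mul_infDist_le {Y : Type*} [SeminormedAddCommGroup Y] [NormedSpace ℝ Y]
    {C : Set Y} (hC : Convex ℝ C) (s : Y) {c : Y} (hc : c ∈ C) {t : ℝ} (ht : 0 ≤ t) :
    (1 + t) * infDist s C ≤ infDist (s + t • (s - c)) C := by
  refine (le_infDist ⟨c, hc⟩).2 fun b hb => ?_
  have ht' : 0 < 1 + t := by positivity
  have hmem : (1 + t)⁻¹ • b + (t * (1 + t)⁻¹) • c ∈ C :=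
    hC hb hc (by positivity) (by positivity) (by field_simp)
  have heq : s + t • (s - c) - b =
      (1 + t) • (s - ((1 + t)⁻¹ • b + (t * (1 + t)⁻¹) • c)) := by
    rw [smul_sub (1 + t), smul_add, smul_smul, smul_smul, mul_inv_cancel₀ ht'.ne',
      show (1 + t) * (t * (1 + t)⁻¹) = t by field_simp]
    module
  rw [dist_eq_norm, heq, norm_smul, Real.norm_of_nonneg ht'.le, ← dist_eq_norm]
  exact mul_le_mul_of_nonneg_left (infDist_le_dist_of_mem hmem) ht'.le

/-- If the `ρ`-ball around a point outside a convex set stays within distance `M` of the set,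
then the point itself lies within distance `M - ρ`. -/
theorem Convex.infDist_add_le_of_forall_closedBall {Y : Type*} [SeminormedAddCommGroup Y]
    [NormedSpace ℝ Y] {C : Set Y} (hC : Convex ℝ C) (hne : C.Nonempty) {s : Y} {ρ M : ℝ}
    (hs : 0 < infDist s C) (hρ : 0 ≤ ρ)
    (h : ∀ y ∈ closedBall s ρ, infDist y C ≤ M) : infDist s C + ρ ≤ M := by
  have key : ∀ c ∈ C, ρ * infDist s C ≤ (M - infDist s C) * dist s c := by
    intro c hc
    have hd : 0 < dist s c := hs.trans_le (infDist_le_dist_of_mem hc)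
    have hy := h (s + (ρ / dist s c) • (s - c)) (by
      rw [Metric.mem_closedBall, dist_self_add_left, norm_smul, ← dist_eq_norm,
        Real.norm_of_nonneg (by positivity), div_mul_cancel₀ _ hd.ne'])
    have hle := (hC.one_add_mul_infDist_le s hc (by positivity : 0 ≤ ρ / dist s c)).trans hy
    have : ρ * infDist s C / dist s c ≤ M - infDist s C := by
      have : ρ * infDist s C / dist s c = ρ / dist s c * infDist s C := by ring
      linarith
    exact (div_le_iff₀ hd).1 this
  have hM : 0 ≤ M - infDist s C := sub_nonneg.2 (h s (Metric.mem_closedBall_self hρ))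
  have hlim : ρ * infDist s C ≤ (M - infDist s C) * infDist s C := by
    refine le_of_forall_pos_le_add fun ε hε => ?_
    have hpos : 0 < M - infDist s C + 1 := by linarith
    obtain ⟨c, hc, hlt⟩ := (infDist_lt_iff hne).1
      (lt_add_of_pos_right (infDist s C) (div_pos hε hpos))
    calc ρ * infDist s C ≤ (M - infDist s C) * dist s c := key c hc
      _ ≤ (M - infDist s C) * (infDist s C + ε / (M - infDist s C + 1)) := by gcongr
      _ = (M - infDist s C) * infDist s C +
          (M - infDist s C) * (ε / (M - infDist s C + 1)) := by ring
      _ ≤ (M - infDist s C) * infDist s C +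
          (M - infDist s C + 1) * (ε / (M - infDist s C + 1)) := by gcongr; linarith
      _ = (M - infDist s C) * infDist s C + ε := by rw [mul_div_cancel₀ _ hpos.ne']
  have := le_of_mul_le_mul_right hlim hs
  linarith

theorem infDist_le_toReal_excess {Y : Type*} [PseudoMetricSpace Y] {S C : Set Y}
    (h : excess S C ≠ ⊤) {s : Y} (hs : s ∈ S) : infDist s C ≤ (excess S C).toReal :=
  ENNReal.toReal_mono h (le_iSup₂ (f := fun a (_ : a ∈ S) => infEDist a C) s hs)

theorem excess_le_ofReal {Y : Type*} [PseudoMetricSpace Y] {S C : Set Y} (hC : C.Nonempty)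
    {M : ℝ} (h : ∀ s ∈ S, infDist s C ≤ M) : excess S C ≤ ENNReal.ofReal M :=
  iSup₂_le fun s hs =>
    ENNReal.le_ofReal_iff_toReal_le (infEDist_ne_top hC) (infDist_nonneg.trans (h s hs)) |>.2
      (h s hs)

theorem IsClosedConvexCone.le_one_of_cthickening_subset {Y : Type*} [SeminormedAddCommGroup Y]
    [NormedSpace ℝ Y] {C : Set Y} (hC : IsClosedConvexCone C) {S : Set Y} (hS : S.Nonempty)
    (hpos : 0 < excess S C) (htop : excess S C ≠ ⊤) {r : ℝ} (hr : 0 < r) {α : ℝ} (hα : 0 < α)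
    (hsub : cthickening (α * r) S ⊆ cthickening r (S + C)) : α ≤ 1 := by
  have hCne : C.Nonempty := ⟨0, hC.2.2.1⟩
  set e := (excess S C).toReal with he
  have he0 : 0 < e := ENNReal.toReal_pos hpos.ne' htop
  have hball : ∀ y ∈ cthickening r (S + C), infDist y C ≤ e + r := by
    intro y hy
    refine le_of_forall_pos_le_add fun ε hε => ?_
    have hy' : infDist y (S + C) < r + ε :=
      (ENNReal.toReal_le_of_le_ofReal hr.le hy).trans_lt (lt_add_of_pos_right r hε)
    obtain ⟨_, ⟨s, hs, c, hc, rfl⟩, hlt⟩ := (infDist_lt_iff (hS.add hCne)).1 hy'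
    have h₁ := infDist_le_infDist_add_dist (s := C) (x := y) (y := s + c)
    have h₂ := hC.infDist_add_le s hc
    have h₃ := infDist_le_toReal_excess htop hs
    dsimp only at hlt
    linarith
  have hfar : ∀ s ∈ S, infDist s C ≤ max 0 (e + r - α * r) := by
    intro s hs
    rcases (infDist_nonneg (x := s) (s := C)).eq_or_lt with h | h
    · exact h.symm.trans_le (le_max_left _ _)
    · have := hC.2.1.infDist_add_le_of_forall_closedBall hCne h (by positivity : 0 ≤ α * r)
        fun y hy => hball y (hsub (closedBall_subset_cthickening hs _ hy))
      exact le_max_of_le_right (by linarith)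
  have hle : e ≤ max 0 (e + r - α * r) :=
    ENNReal.toReal_le_of_le_ofReal (le_max_left _ _) (excess_le_ofReal hCne hfar)
  have : α * r ≤ 1 * r := by
    rcases le_max_iff.1 hle with h | h <;> linarith
  exact le_of_mul_le_mul_right this hr

/-- The inclusion `B(S,αr) ⊆ B(S+C,r)` forces `α ≤ 1` when `0 < e(S,C) < ∞`;
consequently, in the definition of `C`-increase at a point `x₀` with `G(x₀) ⊄ C`,
the witness `u` must differ from `x₀`. -/
theorem stmt3 {X Y : Type*} [MetricSpace X]
    [NormedAddCommGroup Y] [NormedSpace ℝ Y]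
    (C : Set Y) (hC : IsClosedConvexCone C) (hCne : ({0} : Set Y) ≠ C)
    (hCpr : C ≠ Set.univ) :
    (∀ S : Set Y, S.Nonempty → 0 < excess S C → excess S C ≠ ⊤ →
      ∀ r : ℝ, 0 < r → ∀ α : ℝ, 0 < α →
        Metric.cthickening (α * r) S ⊆ Metric.cthickening r (S + C) → α ≤ 1) ∧
    (∀ (G : X → Set Y) (x₀ : X), ¬ (G x₀ ⊆ C) →
      0 < excess (G x₀) C → excess (G x₀) C ≠ ⊤ →
      ∀ α : ℝ, 1 < α → ∀ r : ℝ, 0 < r → ∀ u : X,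
        Metric.cthickening (α * r) (G u) ⊆ Metric.cthickening r (G x₀ + C) →
        u ≠ x₀) := by
  have main := fun (S : Set Y) (hS : S.Nonempty) (hpos : 0 < excess S C) (htop : excess S C ≠ ⊤)
    (r : ℝ) (hr : 0 < r) (α : ℝ) (hα : 0 < α) =>
    hC.le_one_of_cthickening_subset hS hpos htop hr hα
  refine ⟨main, ?_⟩
  rintro G _ hG hpos htop α hα r hr u hsub rfl
  obtain ⟨s, hs, -⟩ := Set.not_subset.1 hG
  exact hα.not_ge (main _ ⟨s, hs⟩ hpos htop r hr α (zero_lt_one.trans hα) hsub)
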